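/- The connected sum of two copies of S² × S¹ satisfies TC((S² × S¹) # (S² × S¹)) ≤ 5. -/

import Mathlib

/-!
Common definitions: rational singular (co)homology, homotopy groups and asphericity,
classifying maps, closed oriented manifolds, connected sums, wedges, topological
complexity, sectional category weights, and (a)toroidal classes.
-/

open CategoryTheory unitInterval Topology

noncomputable section

/-- The singular chain complex with rational coefficients. -/
def singularChainComplex : TopCat.{0} ⥤ ChainComplex (ModuleCat.{0} ℚ) ℕ :=
  TopCat.toSSet ⋙ ((SimplicialObject.whiskering _ _).obj (ModuleCat.free ℚ)) ⋙
    AlgebraicTopology.alternatingFaceMapComplex (ModuleCat ℚ)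

/-- The `k`-th singular homology functor with rational coefficients. -/
def singularHomologyFunctor (k : ℕ) : TopCat.{0} ⥤ ModuleCat.{0} ℚ :=
  singularChainComplex ⋙ HomologicalComplex.homologyFunctor (ModuleCat ℚ) (ComplexShape.down ℕ) k

/-- `H k X` is the `k`-th rational singular homology group `H_k(X; ℚ)`. -/
abbrev H (k : ℕ) (X : Type) [TopologicalSpace X] : Type :=
  (singularHomologyFunctor k).obj (TopCat.of X)

/-- The map `H_k(f; ℚ)` induced on rational singular homology by a continuous map `f`. -/
def Hmap (k : ℕ) {X Y : Type} [TopologicalSpace X] [TopologicalSpace Y] (f : C(X, Y)) :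
    H k X →ₗ[ℚ] H k Y :=
  ((singularHomologyFunctor k).map (TopCat.ofHom f : TopCat.of X ⟶ TopCat.of Y)).hom

/-- `Hco k X` is the `k`-th rational singular cohomology group `H^k(X; ℚ)`; over the
field `ℚ`, universal coefficients identify it naturally with the dual of homology. -/
abbrev Hco (k : ℕ) (X : Type) [TopologicalSpace X] : Type :=
  Module.Dual ℚ (H k X)

/-- The map `H^k(f; ℚ)` induced on rational singular cohomology (the Kronecker-dual
of the map induced on homology). -/
def Hcomap (k : ℕ) {X Y : Type} [TopologicalSpace X] [TopologicalSpace Y] (f : C(X, Y)) :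
    Hco k Y →ₗ[ℚ] Hco k X :=
  (Hmap k f).dualMap

/-- Transport of a cohomology class along an equality of degrees. -/
def coCast {X : Type} [TopologicalSpace X] {p q : ℕ} (h : p = q) :
    Hco p X →ₗ[ℚ] Hco q X := by
  subst h; exact LinearMap.id

/-- A non-zero element spanning a rational vector space (necessarily one-dimensional);
this characterises fundamental classes in the top (co)homology of closed connected
oriented manifolds with rational coefficients. -/
def IsGenerator {W : Type} [AddCommGroup W] [Module ℚ W] (w : W) : Prop :=
  w ≠ 0 ∧ ∀ v : W, ∃ c : ℚ, v = c • w

/-- `π₂(X) = 0`. -/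
def Pi2Trivial (X : Type) [TopologicalSpace X] : Prop :=
  ∀ x : X, Subsingleton (HomotopyGroup (Fin 2) X x)

/-- A space is aspherical iff all its homotopy groups in degrees `≥ 2` vanish
(for manifolds this is equivalent to contractibility of the universal cover). -/
def Aspherical (X : Type) [TopologicalSpace X] : Prop :=
  ∀ k : ℕ, 2 ≤ k → ∀ x : X, Subsingleton (HomotopyGroup (Fin k) X x)

/-- A continuous map, regarded as a morphism in `TopCat`. -/
def toTopHom {X Y : Type} [TopologicalSpace X] [TopologicalSpace Y] (f : C(X, Y)) :
    TopCat.of X ⟶ TopCat.of Y := TopCat.ofHom f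

/-- The homomorphism induced by a continuous map on fundamental groups. -/
def π₁map {X Y : Type} [TopologicalSpace X] [TopologicalSpace Y] (f : C(X, Y)) (x : X) :
    FundamentalGroup X x →* FundamentalGroup Y (f x) :=
  Functor.mapEnd (X := FundamentalGroupoid.mk x)
    (show FundamentalGroupoid X ⥤ FundamentalGroupoid Y from
      FundamentalGroupoid.fundamentalGroupoidFunctor.map (toTopHom f))

/-- `B` is a model for an Eilenberg–MacLane space `K(G, 1)`:  it is path-connected and
all its higher homotopy groups vanish. -/
def IsAsphericalSpace (B : Type) [TopologicalSpace B] : Prop :=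
  PathConnectedSpace B ∧ Aspherical B

/-- `c : M → B` is a classifying map for `M`, i.e. `B` is a model for `Bπ₁(M)`
(path-connected with vanishing higher homotopy groups) and `c` induces an isomorphism
on fundamental groups. -/
def IsClassifyingMap {M B : Type} [TopologicalSpace M] [TopologicalSpace B]
    (c : C(M, B)) : Prop :=
  IsAsphericalSpace B ∧ ∀ x : M, Function.Bijective (π₁map c x)

/-- Every point has a neighbourhood homeomorphic to `ℝⁿ`. -/
def IsLocallyEuclidean (n : ℕ) (M : Type) [TopologicalSpace M] : Prop :=
  ∀ x : M, ∃ U : Set M, x ∈ U ∧ IsOpen U ∧ Nonempty (U ≃ₜ EuclideanSpace ℝ (Fin n))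

/-- A closed connected oriented topological `n`-manifold.  (For a closed connected
`n`-manifold, orientability is equivalent to `H_n(M; ℚ) ≠ 0`.) -/
def IsClosedOrientedManifold (n : ℕ) (M : Type) [TopologicalSpace M] : Prop :=
  CompactSpace M ∧ T2Space M ∧ SecondCountableTopology M ∧ ConnectedSpace M ∧
    IsLocallyEuclidean n M ∧ Nontrivial (H n M)

/-- Data exhibiting `N` as a connected sum `M₁ # M₂` of `n`-manifolds:  `N` is covered by
two closed pieces `C₁`, `C₂`, homeomorphic to `M₁` resp. `M₂` with an embedded open ball
removed, which overlap exactly along the boundary spheres.  (Gluing along any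
homeomorphism of the sphere yields a space homeomorphic to the connected sum.) -/
structure ConnectedSumData (n : ℕ) (N M₁ M₂ : Type) [TopologicalSpace N]
    [TopologicalSpace M₁] [TopologicalSpace M₂] where
  φ₁ : EuclideanSpace ℝ (Fin n) → M₁
  φ₂ : EuclideanSpace ℝ (Fin n) → M₂
  emb₁ : IsOpenEmbedding φ₁
  emb₂ : IsOpenEmbedding φ₂
  C₁ : Set N
  C₂ : Set N
  closed₁ : IsClosed C₁
  closed₂ : IsClosed C₂
  cover : C₁ ∪ C₂ = Set.univ
  h₁ : C₁ ≃ₜ ((φ₁ '' Metric.ball 0 1)ᶜ : Set M₁)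
  h₂ : C₂ ≃ₜ ((φ₂ '' Metric.ball 0 1)ᶜ : Set M₂)
  inter₁ : ∀ x : C₁, (x : N) ∈ C₂ ↔ ((h₁ x : M₁) ∈ φ₁ '' Metric.sphere 0 1)
  inter₂ : ∀ x : C₂, (x : N) ∈ C₁ ↔ ((h₂ x : M₂) ∈ φ₂ '' Metric.sphere 0 1)

/-- `N` is a connected sum of `M₁` and `M₂` (as `n`-manifolds). -/
def IsConnectedSum (n : ℕ) (N M₁ M₂ : Type) [TopologicalSpace N]
    [TopologicalSpace M₁] [TopologicalSpace M₂] : Prop :=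
  Nonempty (ConnectedSumData n N M₁ M₂)

/-- The degree-one pinch map `N = M₁ # M₂ → M₁`:  it restricts to the canonical
identification on the `M₁`-piece and sends the `M₂`-piece into the closed ball. -/
def ConnectedSumData.IsPinchFst {n : ℕ} {N M₁ M₂ : Type} [TopologicalSpace N]
    [TopologicalSpace M₁] [TopologicalSpace M₂] (D : ConnectedSumData n N M₁ M₂)
    (p : C(N, M₁)) : Prop :=
  (∀ x : D.C₁, p (x : N) = (D.h₁ x : M₁)) ∧
    ∀ x : D.C₂, p (x : N) ∈ D.φ₁ '' Metric.closedBall 0 1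

/-- The degree-one pinch map `N = M₁ # M₂ → M₂`. -/
def ConnectedSumData.IsPinchSnd {n : ℕ} {N M₁ M₂ : Type} [TopologicalSpace N]
    [TopologicalSpace M₁] [TopologicalSpace M₂] (D : ConnectedSumData n N M₁ M₂)
    (p : C(N, M₂)) : Prop :=
  (∀ x : D.C₂, p (x : N) = (D.h₂ x : M₂)) ∧
    ∀ x : D.C₁, p (x : N) ∈ D.φ₂ '' Metric.closedBall 0 1

/-- `N` is an iterated connected sum `M 0 # M 1 # ⋯ # M (m-1)` of `n`-manifolds. -/
def IsIteratedConnectedSum (n : ℕ) (N : Type) [TopologicalSpace N] :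
    (m : ℕ) → (Fin m → TopCat.{0}) → Prop
  | 0, _ => False
  | 1, M => Nonempty (N ≃ₜ (M 0))
  | (m + 2), M =>
      ∃ P : TopCat.{0}, IsIteratedConnectedSum n P (m + 1) (fun i => M i.castSucc) ∧
        IsConnectedSum n N P (M (Fin.last (m + 1)))

/-- `W` is the wedge (one-point union) of the pointed spaces `(M₁, x₁)` and `(M₂, x₂)`. -/
def IsWedge (W M₁ M₂ : Type) [TopologicalSpace W] [TopologicalSpace M₁]
    [TopologicalSpace M₂] (x₁ : M₁) (x₂ : M₂) : Prop :=
  ∃ (j₁ : C(M₁, W)) (j₂ : C(M₂, W)), IsClosedEmbedding j₁ ∧ IsClosedEmbedding j₂ ∧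
    Set.range j₁ ∪ Set.range j₂ = Set.univ ∧
    Set.range j₁ ∩ Set.range j₂ = {j₁ x₁} ∧ j₁ x₁ = j₂ x₂

/-- `X × X` admits a cover by `m` open sets over each of which there is a continuous
motion planning rule (a continuous local section of the free path fibration). -/
def TCCoverable (X : Type) [TopologicalSpace X] (m : ℕ) : Prop :=
  ∃ U : Fin m → Set (X × X), (∀ i, IsOpen (U i)) ∧ (⋃ i, U i) = Set.univ ∧
    ∀ i, ∃ s : C(U i, C(I, X)),
      ∀ p : U i, (s p) 0 = (p : X × X).1 ∧ (s p) 1 = (p : X × X).2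

/-- The (unreduced) topological complexity of `X`:  the smallest number of open sets in a
cover of `X × X` admitting continuous motion planning rules (`⊤` if there is none). -/
def topologicalComplexity (X : Type) [TopologicalSpace X] : ℕ∞ :=
  sInf {c : ℕ∞ | ∃ m : ℕ, c = m ∧ TCCoverable X m}

/-- The free path fibration `X^{[0,1]} → X × X`, `γ ↦ (γ(0), γ(1))`. -/
def pathFibration (X : Type) [TopologicalSpace X] : C(C(I, X), X × X) :=
  ⟨fun γ => (γ 0, γ 1), (continuous_eval_const 0).prodMk (continuous_eval_const 1)⟩

/-- The Schwarz genus (sectional category) of the pullback of `p` along `f` is at most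
`k`:  `Y` is covered by `k` open sets over each of which `f` lifts continuously
through `p`. -/
def GenusPullbackLE {E B : Type} [TopologicalSpace E] [TopologicalSpace B] (p : C(E, B))
    {Y : Type} [TopologicalSpace Y] (f : C(Y, B)) (k : ℕ) : Prop :=
  ∃ U : Fin k → Set Y, (∀ i, IsOpen (U i)) ∧ (⋃ i, U i) = Set.univ ∧
    ∀ i, ∃ s : C(U i, E), ∀ y : U i, p (s y) = f (y : Y)

/-- The sectional category weight of a cohomology class `u` on the base of `p`:  the
supremum of those `m` such that `u` pulls back to zero along every map `f` for which
the pullback of `p` along `f` has Schwarz genus at most `m`. -/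
def secatWeight {E B : Type} [TopologicalSpace E] [TopologicalSpace B] (p : C(E, B))
    {k : ℕ} (u : Hco k B) : ℕ∞ :=
  sSup {w : ℕ∞ | ∃ m : ℕ, w = m ∧ ∀ (Y : Type) [TopologicalSpace Y] (f : C(Y, B)),
    GenusPullbackLE p f m → Hcomap k f u = 0}

/-- The topological complexity weight:  sectional category weight with respect to the
free path fibration. -/
def tcWeight {X : Type} [TopologicalSpace X] {k : ℕ} (u : Hco k (X × X)) : ℕ∞ :=
  secatWeight (pathFibration X) u

/-- The `n`-dimensional sphere. -/
abbrev unitSphere (n : ℕ) : Type :=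
  ↥(Metric.sphere (0 : EuclideanSpace ℝ (Fin (n + 1))) 1)

/-- The 2-torus `T² = S¹ × S¹`. -/
abbrev Torus2 : Type := unitSphere 1 × unitSphere 1

/-- A degree-two rational homology class `v` is toroidal (relative to a fundamental class
`ωT` of the torus) if some map from the torus realises a non-zero multiple of `v`. -/
def IsToroidal {X : Type} [TopologicalSpace X] (ωT : H 2 Torus2) (v : H 2 X) : Prop :=
  ∃ (f : C(Torus2, X)) (α : ℚ), α ≠ 0 ∧ Hmap 2 f ωT = α • v

/-- A non-zero degree-two rational homology class is atoroidal if it is not toroidal. -/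
def IsAtoroidal {X : Type} [TopologicalSpace X] (ωT : H 2 Torus2) (v : H 2 X) : Prop :=
  v ≠ 0 ∧ ¬ IsToroidal ωT v

/-- A degree-two rational cohomology class `u` is toroidal if it pulls back non-trivially
under some map from the torus. -/
def IsCoToroidal {X : Type} [TopologicalSpace X] (u : Hco 2 X) : Prop :=
  ∃ f : C(Torus2, X), Hcomap 2 f u ≠ 0

/-- A non-zero degree-two rational cohomology class is atoroidal if it pulls back to zero
under every map from the torus. -/
def IsCoAtoroidal {X : Type} [TopologicalSpace X] (u : Hco 2 X) : Prop :=
  u ≠ 0 ∧ ∀ f : C(Torus2, X), Hcomap 2 f u = 0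

/-! ### Null-homotopic subsets and a bound for topological complexity -/

/-- The inclusion of `U` into `X` is homotopic to every constant map. -/
def NullIn {X : Type*} [TopologicalSpace X] (U : Set X) : Prop :=
  ∀ c : X, ContinuousMap.Homotopic (⟨Subtype.val, continuous_subtype_val⟩ : C(U, X))
    (ContinuousMap.const U c)

theorem ContinuousMap.Nullhomotopic.homotopic_const {X Y : Type*} [TopologicalSpace X]
    [TopologicalSpace Y] [PathConnectedSpace Y] {f : C(X, Y)} (hf : f.Nullhomotopic) (c : Y) :
    f.Homotopic (ContinuousMap.const X c) := by
  obtain ⟨y, hy⟩ := hf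
  let γ : Path y c := PathConnectedSpace.somePath y c
  exact hy.trans ⟨⟨⟨fun p => γ p.1, by fun_prop⟩, by simp, by simp⟩⟩

theorem NullIn.of_nullhomotopic {X : Type*} [TopologicalSpace X] [PathConnectedSpace X]
    {U : Set X} (h : (⟨Subtype.val, continuous_subtype_val⟩ : C(U, X)).Nullhomotopic) :
    NullIn U :=
  h.homotopic_const

theorem NullIn.mono {X : Type*} [TopologicalSpace X] {U V : Set X} (h : NullIn V)
    (hUV : U ⊆ V) : NullIn U :=
  fun c => (h c).comp (.refl (ContinuousMap.inclusion hUV))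

/-- A disjoint union of open null-homotopic subsets is null-homotopic. -/
theorem NullIn.iUnion {X ι : Type*} [TopologicalSpace X] {Q : ι → Set X}
    (hopen : ∀ i, IsOpen (Q i)) (hdisj : Pairwise (Function.onFun Disjoint Q))
    (hnull : ∀ i, NullIn (Q i)) : NullIn (⋃ i, Q i) := by
  intro c
  let F := fun i => Classical.choice (hnull i c)
  let S : ι → Set (I × ↥(⋃ i, Q i)) := fun i => {p | (p.2 : X) ∈ Q i}
  have hSopen : ∀ i, IsOpen (S i) := fun i => (hopen i).preimage (by fun_prop)
  let ψ : ∀ i, C(S i, X) := fun i =>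
    ⟨fun p => F i (p.1.1, ⟨p.1.2, p.2⟩), by fun_prop⟩
  have hψ : ∀ (i j) (x : I × ↥(⋃ i, Q i)) (hxi : x ∈ S i) (hxj : x ∈ S j),
      ψ i ⟨x, hxi⟩ = ψ j ⟨x, hxj⟩ := by
    intro i j x hxi hxj
    obtain rfl : i = j := by
      by_contra hij
      exact Set.disjoint_left.1 (hdisj hij) hxi hxj
    rfl
  have hS : ∀ x, ∃ i, S i ∈ 𝓝 x := by
    intro x
    obtain ⟨i, hi⟩ := Set.mem_iUnion.1 x.2.2
    exact ⟨i, (hSopen i).mem_nhds hi⟩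
  refine ⟨⟨ContinuousMap.liftCover S ψ hψ hS, fun x => ?_, fun x => ?_⟩⟩
  all_goals
    obtain ⟨i, hi⟩ := Set.mem_iUnion.1 x.2
  · exact (ContinuousMap.liftCover_coe (S := S) (i := i) ⟨(0, x), hi⟩).trans
      ((F i).apply_zero ⟨x, hi⟩)
  · exact (ContinuousMap.liftCover_coe (S := S) (i := i) ⟨(1, x), hi⟩).trans
      ((F i).apply_one ⟨x, hi⟩)

theorem NullIn.union {X : Type*} [TopologicalSpace X] {U V : Set X} (hU : IsOpen U)
    (hV : IsOpen V) (hUV : Disjoint U V) (hnU : NullIn U) (hnV : NullIn V) :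
    NullIn (U ∪ V) := by
  rw [Set.union_eq_iUnion]
  refine NullIn.iUnion ?_ ?_ ?_
  · rintro (_ | _) <;> assumption
  · rintro (_ | _) (_ | _) h
    · exact absurd rfl h
    · exact hUV.symm
    · exact hUV
    · exact absurd rfl h
  · rintro (_ | _) <;> assumption

theorem NullIn.prod {X Y : Type*} [TopologicalSpace X] [TopologicalSpace Y] {U : Set X}
    {V : Set Y} (hU : NullIn U) (hV : NullIn V) : NullIn (U ×ˢ V) := by
  rintro ⟨a, b⟩
  have hfst := (hU a).comp (.refl (⟨fun z => ⟨z.1.1, z.2.1⟩, by fun_prop⟩ : C(↥(U ×ˢ V), U)))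
  have hsnd := (hV b).comp (.refl (⟨fun z => ⟨z.1.2, z.2.2⟩, by fun_prop⟩ : C(↥(U ×ˢ V), V)))
  exact hfst.prodMk hsnd

/-- A null-homotopic subset of `X × X` carries a continuous motion planning rule. -/
theorem NullIn.exists_section {X : Type} [TopologicalSpace X] {W : Set (X × X)}
    (hW : NullIn W) :
    ∃ s : C(W, C(I, X)), ∀ p : W, (s p) 0 = (p : X × X).1 ∧ (s p) 1 = (p : X × X).2 := by
  rcases W.eq_empty_or_nonempty with rfl | ⟨⟨a, b⟩, -⟩
  · exact ⟨⟨fun p => p.2.elim, continuous_of_const fun p => p.2.elim⟩, fun p => p.2.elim⟩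
  have hfst := ContinuousMap.Homotopic.comp (.refl (ContinuousMap.fst : C(X × X, X))) (hW (a, a))
  have hsnd := ContinuousMap.Homotopic.comp (.refl (ContinuousMap.snd : C(X × X, X))) (hW (a, a))
  obtain ⟨G⟩ := hfst.trans hsnd.symm
  refine ⟨ContinuousMap.curry ⟨fun q => G (q.2, q.1), by fun_prop⟩, fun p => ⟨?_, ?_⟩⟩
  · exact G.apply_zero p
  · exact G.apply_one p

/-- Finitely many pairwise separated subsets of a metric space have pairwise disjoint open
neighbourhoods. -/
theorem exists_isOpen_pairwise_disjoint_of_separated {Z ι : Type*} [PseudoEMetricSpace Z]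
    [Finite ι] (S : ι → Set Z) (hS : ∀ i j, i ≠ j → Disjoint (S i) (closure (S j))) :
    ∃ Q : ι → Set Z, (∀ i, IsOpen (Q i)) ∧ (∀ i, S i ⊆ Q i) ∧
      Pairwise (Function.onFun Disjoint Q) := by
  refine ⟨fun i => ⋂ j, ⋂ (_ : i ≠ j), {z | Metric.infEDist z (S i) < Metric.infEDist z (S j)},
    fun i => ?_, fun i z hz => ?_, fun i j hij => ?_⟩
  · refine isOpen_iInter_of_finite fun j => isOpen_iInter_of_finite fun _ => ?_
    exact isOpen_lt Metric.continuous_infEDist Metric.continuous_infEDist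
  · simp only [Set.mem_iInter, Set.mem_ofPred_eq]
    intro j hij
    rw [Metric.infEDist_zero_of_mem hz]
    exact Metric.infEDist_pos_iff_notMem_closure.2 (Set.disjoint_left.1 (hS i j hij) hz)
  · refine Set.disjoint_left.2 fun z hi hj => ?_
    simp only [Set.mem_iInter, Set.mem_ofPred_eq] at hi hj
    exact lt_asymm (hi j hij) (hj i hij.symm)

/-- The points of `ℝⁿ` whose first positive coordinate is the `i`-th one. -/
def firstPositive {n : ℕ} (i : Fin n) : Set (Fin n → ℝ) :=
  {t | 0 < t i ∧ ∀ j < i, t j ≤ 0}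

theorem exists_mem_firstPositive {n : ℕ} {t : Fin n → ℝ} (ht : ∃ i, 0 < t i) :
    ∃ i, t ∈ firstPositive i := by
  obtain ⟨i, hi, hmin⟩ := WellFounded.has_min (wellFounded_lt (α := Fin n)) {i | 0 < t i} ht
  exact ⟨i, hi, fun j hj => not_lt.1 fun h => hmin j h hj⟩

theorem le_of_mem_firstPositive_of_mem_closure {n : ℕ} {i j : Fin n} {t : Fin n → ℝ}
    (hi : t ∈ firstPositive i) (hj : t ∈ closure (firstPositive j)) : j ≤ i := by
  by_contra! h
  have hcl : IsClosed {t : Fin n → ℝ | t i ≤ 0} :=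
    isClosed_le (continuous_apply i) continuous_const
  have : t i ≤ 0 := closure_minimal (fun s hs => hs.2 i h) hcl hj
  exact this.not_gt hi.1

/-- If a normal space is covered by `n` null-homotopic open sets, then its topological complexity
is at most `2n - 1`. -/
theorem TCCoverable.of_nullIn {X : Type} [TopologicalSpace X] [NormalSpace X] {n : ℕ}
    (U : Fin n → Set X) (hopen : ∀ i, IsOpen (U i)) (hcover : ⋃ i, U i = Set.univ)
    (hnull : ∀ i, NullIn (U i)) : TCCoverable X (2 * n - 1) := by
  obtain ⟨f, hf⟩ := PartitionOfUnity.exists_isSubordinate_of_locallyFinite isClosed_univ U hopen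
    (locallyFinite_of_finite U) hcover.ge
  have hfU : ∀ i x, 0 < f i x → x ∈ U i := fun i x hx =>
    hf i (subset_tsupport _ (Function.mem_support.2 hx.ne'))
  let g : X → Fin n → ℝ := fun x i => f i x
  have hg : Continuous g := continuous_pi fun i => (f i).continuous
  let J : ℕ → Type := fun k => {ij : Fin n × Fin n // (ij.1 : ℕ) + ij.2 = k}
  let S : ∀ k, J k → Set ((Fin n → ℝ) × (Fin n → ℝ)) := fun k ij =>
    firstPositive ij.1.1 ×ˢ firstPositive ij.1.2
  have hS : ∀ k (a b : J k), a ≠ b → Disjoint (S k a) (closure (S k b)) := by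
    intro k a b hab
    refine Set.disjoint_left.2 fun z hza hzb => hab ?_
    rw [closure_prod_eq] at hzb
    have h1 := le_of_mem_firstPositive_of_mem_closure hza.1 hzb.1
    have h2 := le_of_mem_firstPositive_of_mem_closure hza.2 hzb.2
    have ha := a.2
    have hb := b.2
    apply Subtype.ext
    apply Prod.ext <;> apply Fin.ext <;> simp only [Fin.le_def] at h1 h2 <;> omega
  have : ∀ k, Finite (J k) := fun k => by dsimp only [J]; infer_instance
  choose Q hQopen hSQ hQdisj using fun k =>
    exists_isOpen_pairwise_disjoint_of_separated (S k) (hS k)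
  let R : ∀ k, J k → Set (X × X) := fun k ij =>
    (fun p : X × X => (g p.1, g p.2)) ⁻¹' Q k ij ∩ U ij.1.1 ×ˢ U ij.1.2
  have hRopen : ∀ k ij, IsOpen (R k ij) := fun k ij =>
    ((hQopen k ij).preimage (by fun_prop)).inter ((hopen _).prod (hopen _))
  refine ⟨fun k => ⋃ ij, R k ij, fun k => isOpen_iUnion (hRopen k), ?_, fun k => ?_⟩
  · refine Set.eq_univ_of_forall fun p => ?_
    have hpos : ∀ x, ∃ i, 0 < g x i := fun x => f.exists_pos (Set.mem_univ x)
    obtain ⟨i, hi⟩ := exists_mem_firstPositive (hpos p.1)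
    obtain ⟨j, hj⟩ := exists_mem_firstPositive (hpos p.2)
    refine Set.mem_iUnion.2 ⟨⟨i + j, by omega⟩, Set.mem_iUnion.2 ⟨⟨(i, j), rfl⟩, ?_, ?_, ?_⟩⟩
    · exact hSQ _ _ ⟨hi, hj⟩
    · exact hfU _ _ hi.1
    · exact hfU _ _ hj.1
  · refine NullIn.exists_section (NullIn.iUnion (hRopen k) (fun a b hab => ?_) fun ij => ?_)
    · exact ((hQdisj k hab).preimage _).mono Set.inter_subset_left Set.inter_subset_left
    · exact ((hnull _).prod (hnull _)).mono Set.inter_subset_right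

/-! ### Radial projection out of a ball -/

section RadialProjection

variable {E : Type*} [NormedAddCommGroup E] [InnerProductSpace ℝ E]

/-- The projection from the point `z` of the open unit ball onto the complement of that ball. -/
def radialProj (z w : E) : E :=
  w + ((-inner ℝ w (w - z) + √(inner ℝ w (w - z) ^ 2 + ‖w - z‖ ^ 2 * max 0 (1 - ‖w‖ ^ 2)))
    / ‖w - z‖ ^ 2) • (w - z)

theorem continuousOn_radialProj (z : E) : ContinuousOn (radialProj z) {z}ᶜ := by
  unfold radialProj
  refine continuousOn_id.add (ContinuousOn.smul (ContinuousOn.div ?_ ?_ ?_) ?_)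
  · fun_prop
  · fun_prop
  · intro w hw
    simpa [sub_eq_zero] using hw
  · fun_prop

theorem radialProj_of_one_le {z w : E} (hz : ‖z‖ < 1) (hw : 1 ≤ ‖w‖) : radialProj z w = w := by
  have hinner : 0 ≤ inner ℝ w (w - z) := by
    rw [inner_sub_right, real_inner_self_eq_norm_sq]
    have := real_inner_le_norm w z
    nlinarith [norm_nonneg z]
  have hmax : max 0 (1 - ‖w‖ ^ 2) = 0 := max_eq_left (by nlinarith)
  simp [radialProj, hmax, Real.sqrt_sq hinner]

theorem one_le_norm_radialProj {z w : E} (hz : ‖z‖ < 1) (hwz : w ≠ z) :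
    1 ≤ ‖radialProj z w‖ := by
  rcases le_total 1 ‖w‖ with hw | hw
  · rwa [radialProj_of_one_le hz hw]
  have hmax : max 0 (1 - ‖w‖ ^ 2) = 1 - ‖w‖ ^ 2 :=
    max_eq_right (by nlinarith [norm_nonneg w])
  have hv : 0 < ‖w - z‖ ^ 2 := by
    have := norm_pos_iff.2 (sub_ne_zero.2 hwz)
    positivity
  have hnonneg : 0 ≤ inner ℝ w (w - z) ^ 2 + ‖w - z‖ ^ 2 * (1 - ‖w‖ ^ 2) := by
    have : 0 ≤ 1 - ‖w‖ ^ 2 := by nlinarith [norm_nonneg w]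
    positivity
  have hsq := Real.sq_sqrt hnonneg
  have key : ‖radialProj z w‖ ^ 2 = 1 := by
    rw [radialProj, hmax, norm_add_sq_real, inner_smul_right, norm_smul, mul_pow,
      Real.norm_eq_abs, sq_abs]
    set a := inner ℝ w (w - z)
    set b := ‖w - z‖ ^ 2
    set r := √(a ^ 2 + b * (1 - ‖w‖ ^ 2))
    field_simp
    linear_combination hsq
  nlinarith [norm_nonneg (radialProj z w)]

end RadialProjection

open Set Metric in
/-- If `φ` is an open embedding of Euclidean space into a Hausdorff space `M`, then `M` with a point
of the open unit ball removed retracts onto the complement of the ball. -/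
theorem exists_retraction_compl_ball {n : ℕ} {M : Type*} [TopologicalSpace M] [T2Space M]
    {φ : EuclideanSpace ℝ (Fin n) → M} (hφ : IsOpenEmbedding φ)
    {z : EuclideanSpace ℝ (Fin n)} (hz : ‖z‖ < 1) :
    ∃ r : C(↥({φ z}ᶜ : Set M), ↥((φ '' ball 0 1)ᶜ : Set M)),
      ∀ m (hm : m ∈ (φ '' ball 0 1)ᶜ) (hm' : m ∈ ({φ z}ᶜ : Set M)),
        r ⟨m, hm'⟩ = ⟨m, hm⟩ := by
  classical
  let e := hφ.toOpenPartialHomeomorph φ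
  let r₀ : M → M := fun m => if m ∈ range φ then φ (radialProj z (e.symm m)) else m
  have hr₀φ : ∀ w, r₀ (φ w) = φ (radialProj z w) := by
    intro w
    have : e.symm (φ w) = w := hφ.toOpenPartialHomeomorph_left_inv φ
    simp only [r₀, mem_range_self, if_true, this]
  have hid : ∀ m ∈ (φ '' ball 0 1)ᶜ, r₀ m = m := by
    intro m hm
    by_cases h : m ∈ range φ
    · obtain ⟨w, rfl⟩ := h
      rw [hr₀φ, radialProj_of_one_le hz]
      by_contra! hw
      exact hm ⟨w, by simpa using hw, rfl⟩
    · simp only [r₀, h, if_false]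
  have hcont : ContinuousOn r₀ {φ z}ᶜ := by
    have hclosed : IsClosed (φ '' closedBall 0 1) :=
      ((isCompact_closedBall 0 1).image hφ.continuous).isClosed
    have hcover : ({φ z}ᶜ : Set M) ⊆ φ '' {z}ᶜ ∪ (φ '' closedBall 0 1)ᶜ := by
      intro m hm
      by_cases h : m ∈ φ '' closedBall 0 1
      · obtain ⟨w, -, rfl⟩ := h
        exact Or.inl ⟨w, fun h => hm (by rw [mem_singleton_iff.1 h]; rfl), rfl⟩
      · exact Or.inr h
    refine ContinuousOn.mono (ContinuousOn.union_of_isOpen ?_ ?_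
      (hφ.isOpenMap _ isOpen_compl_singleton) hclosed.isOpen_compl) hcover
    · have hsymm : ContinuousOn e.symm (range φ) := by
        simpa [e] using e.continuousOn_symm
      refine ContinuousOn.congr (f := fun m => φ (radialProj z (e.symm m))) ?_ ?_
      · refine hφ.continuous.comp_continuousOn
          ((continuousOn_radialProj z).comp (hsymm.mono (image_subset_range _ _)) ?_)
        rintro _ ⟨w, hw, rfl⟩
        rwa [show e.symm (φ w) = w from hφ.toOpenPartialHomeomorph_left_inv φ]
      · rintro _ ⟨w, hw, rfl⟩
        simp only [r₀, mem_range_self, if_true]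
    · exact continuousOn_id.congr fun m hm => hid m fun h => hm (image_mono ball_subset_closedBall h)
  have hmem : ∀ m ∈ ({φ z}ᶜ : Set M), r₀ m ∈ (φ '' ball 0 1)ᶜ := by
    intro m hm
    by_cases h : m ∈ φ '' ball 0 1
    · obtain ⟨w, -, rfl⟩ := h
      rw [hr₀φ]
      rintro ⟨v, hv, hvw⟩
      rw [hφ.injective hvw] at hv
      have := one_le_norm_radialProj hz (w := w) fun h => hm (by rw [h]; rfl)
      exact absurd (mem_ball_zero_iff.1 hv) this.not_gt
    · rwa [hid m h]
  refine ⟨⟨fun m => ⟨r₀ m, hmem m m.2⟩, ?_⟩, fun m hm hm' => Subtype.ext (hid m hm)⟩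
  exact (continuousOn_iff_continuous_domRestrict.1 hcont).subtype_mk _

/-! ### Punctured products of spheres -/

theorem contractibleSpace_compl_singleton_unitSphere (n : ℕ) (v : unitSphere n) :
    ContractibleSpace ↥({v}ᶜ : Set (unitSphere n)) := by
  have : Fact (Module.finrank ℝ (EuclideanSpace ℝ (Fin (n + 1))) = n + 1) :=
    ⟨finrank_euclideanSpace_fin⟩
  have h := (stereographic' n v).toHomeomorphSourceTarget
  rw [stereographic'_source, stereographic'_target] at h
  exact (h.trans (Homeomorph.Set.univ _)).contractibleSpace

theorem pathConnectedSpace_unitSphere (n : ℕ) : PathConnectedSpace (unitSphere (n + 1)) := by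
  rw [← isPathConnected_iff_pathConnectedSpace]
  refine isPathConnected_sphere ?_ 0 zero_le_one
  rw [← Module.finrank_eq_rank, finrank_euclideanSpace_fin]
  exact_mod_cast (by omega : 1 < n + 1 + 1)

theorem compl_singleton_unitSphere_nonempty {n : ℕ} (v : unitSphere n) :
    ({v}ᶜ : Set (unitSphere n)).Nonempty :=
  ⟨-v, fun h => ne_neg_of_mem_unit_sphere ℝ v (Set.mem_singleton_iff.1 h).symm⟩

theorem contractibleSpace_compl_prod_compl {k l : ℕ} (u : unitSphere k) (s : unitSphere l) :
    ContractibleSpace ↥(({u}ᶜ : Set (unitSphere k)) ×ˢ ({s}ᶜ : Set (unitSphere l))) := by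
  have := contractibleSpace_compl_singleton_unitSphere k u
  have := contractibleSpace_compl_singleton_unitSphere l s
  exact (Homeomorph.Set.prod _ _).contractibleSpace

theorem isPathConnected_compl_singleton_prod_unitSphere {k l : ℕ}
    (p : unitSphere (k + 1) × unitSphere (l + 1)) : IsPathConnected {p}ᶜ := by
  have hk := pathConnectedSpace_unitSphere k
  have hl := pathConnectedSpace_unitSphere l
  have hp1 : IsPathConnected ({p.1}ᶜ : Set (unitSphere (k + 1))) := by
    have := contractibleSpace_compl_singleton_unitSphere _ p.1
    exact isPathConnected_iff_pathConnectedSpace.2 inferInstance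
  have hp2 : IsPathConnected ({p.2}ᶜ : Set (unitSphere (l + 1))) := by
    have := contractibleSpace_compl_singleton_unitSphere _ p.2
    exact isPathConnected_iff_pathConnectedSpace.2 inferInstance
  obtain ⟨u, hu⟩ := compl_singleton_unitSphere_nonempty p.1
  obtain ⟨s, hs⟩ := compl_singleton_unitSphere_nonempty p.2
  have := (hp1.prod isPathConnected_univ).union (isPathConnected_univ.prod hp2)
    ⟨(u, s), ⟨hu, Set.mem_univ _⟩, Set.mem_univ _, hs⟩
  convert this using 1
  ext ⟨a, b⟩
  simp [Prod.ext_iff, imp_iff_not_or]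

theorem dense_setOf_fst_ne_and_snd_ne {k l : ℕ} (y : unitSphere (k + 1) × unitSphere (l + 1)) :
    Dense {p : unitSphere (k + 1) × unitSphere (l + 1) | p.1 ≠ y.1 ∧ p.2 ≠ y.2} := by
  have hne : ∀ (n : ℕ) (v : unitSphere (n + 1)), Dense ({v}ᶜ : Set (unitSphere (n + 1))) := by
    intro n v
    have := pathConnectedSpace_unitSphere n
    have : Nontrivial (unitSphere (n + 1)) :=
      ⟨_, _, (compl_singleton_unitSphere_nonempty v).choose_spec⟩
    exact dense_compl_singleton v
  exact (hne k y.1).prod (hne l y.2)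

open Set in
/-- The complement of a point `p` in a product of two spheres is the union of an open set lying in
a contractible set and of two disjoint such open sets, the closures of which may be chosen to avoid
a point `y` both coordinates of which differ from those of `p`. -/
theorem exists_cover_compl_singleton {k l : ℕ} {p y : unitSphere k × unitSphere l}
    (h₁ : p.1 ≠ y.1) (h₂ : p.2 ≠ y.2) :
    ∃ A B B' : Set (unitSphere k × unitSphere l), IsOpen A ∧ IsOpen B ∧ IsOpen B' ∧
      A ∪ (B ∪ B') = {p}ᶜ ∧ Disjoint B B' ∧ y ∉ closure (B ∪ B') ∧
      ∀ V ∈ ({A, B, B'} : Set (Set _)), ∃ Y ⊆ {p}ᶜ, V ⊆ Y ∧ ContractibleSpace Y := by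
  have hd₁ : 0 < dist y.1 p.1 := dist_pos.2 h₁.symm
  have hd₂ : 0 < dist y.2 p.2 := dist_pos.2 h₂.symm
  have hdist : ∀ {n : ℕ} (a b : unitSphere n), dist a b ≤ 2 := by
    intro n a b
    have := dist_triangle_right (a : EuclideanSpace ℝ (Fin (n + 1))) b 0
    rw [Metric.mem_sphere.1 a.2, Metric.mem_sphere.1 b.2] at this
    rw [Subtype.dist_eq]
    linarith
  have hanti : ∀ {n : ℕ} (a : unitSphere n), dist (-a) a = 2 := by
    intro n a
    rw [Subtype.dist_eq, dist_eq_norm, coe_neg_sphere, ← neg_add', norm_neg, ← two_smul ℝ,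
      norm_smul, mem_sphere_zero_iff_norm.1 a.2]
    norm_num
  obtain ⟨c, hc⟩ := exists_gt
    (max 1 (max (dist y.2 p.2 / dist y.1 p.1) (dist y.1 p.1 / dist y.2 p.2)))
  simp only [max_lt_iff, div_lt_iff₀ hd₁, div_lt_iff₀ hd₂] at hc
  obtain ⟨hc, hc₁, hc₂⟩ := hc
  refine ⟨{p.1}ᶜ ×ˢ {p.2}ᶜ, {q | c * dist q.1 p.1 < dist q.2 p.2},
    {q | c * dist q.2 p.2 < dist q.1 p.1}, isOpen_compl_singleton.prod isOpen_compl_singleton,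
    isOpen_lt (by fun_prop) (by fun_prop), isOpen_lt (by fun_prop) (by fun_prop), ?_, ?_, ?_, ?_⟩
  · ext q
    simp only [mem_union, mem_prod, mem_compl_iff, mem_singleton_iff, mem_ofPred_eq]
    constructor
    · rintro (⟨h, -⟩ | h | h) rfl <;> simp at h
    · intro hq
      by_cases hq₁ : q.1 = p.1
      · have : q.2 ≠ p.2 := fun h => hq (Prod.ext hq₁ h)
        simp [hq₁, this]
      · by_cases hq₂ : q.2 = p.2 <;> simp [hq₁, hq₂]
  · refine disjoint_left.2 fun q h h' => ?_
    simp only [mem_ofPred_eq] at h h'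
    nlinarith [dist_nonneg (x := q.1) (y := p.1), dist_nonneg (x := q.2) (y := p.2)]
  · intro hy
    rw [closure_union] at hy
    rcases hy with hy | hy
    · have := closure_lt_subset_le (by fun_prop) (by fun_prop) hy
      exact hc₁.not_ge this
    · have := closure_lt_subset_le (by fun_prop) (by fun_prop) hy
      exact hc₂.not_ge this
  · simp only [mem_insert_iff, mem_singleton_iff, forall_eq_or_imp, forall_eq]
    refine ⟨⟨_, ?_, subset_rfl, contractibleSpace_compl_prod_compl p.1 p.2⟩,
      ⟨_, ?_, ?_, contractibleSpace_compl_prod_compl (-p.1) p.2⟩,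
      ⟨_, ?_, ?_, contractibleSpace_compl_prod_compl p.1 (-p.2)⟩⟩
    · rintro q ⟨hq, -⟩ rfl
      exact hq rfl
    · rintro q ⟨-, hq⟩ rfl
      exact hq rfl
    · intro q hq
      simp only [mem_ofPred_eq] at hq
      refine ⟨fun h => ?_, fun h => ?_⟩
      · rw [mem_singleton_iff.1 h, hanti] at hq
        linarith [hdist q.2 p.2]
      · rw [mem_singleton_iff.1 h, dist_self] at hq
        nlinarith [dist_nonneg (x := q.1) (y := p.1)]
    · rintro q ⟨hq, -⟩ rfl
      exact hq rfl
    · intro q hq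
      simp only [mem_ofPred_eq] at hq
      refine ⟨fun h => ?_, fun h => ?_⟩
      · rw [mem_singleton_iff.1 h, dist_self] at hq
        nlinarith [dist_nonneg (x := q.2) (y := p.2)]
      · rw [mem_singleton_iff.1 h, hanti] at hq
        linarith [hdist q.1 p.1]

/-! ### Connected sums -/

theorem t2Space_of_closed_union {X : Type*} [TopologicalSpace X] {C₁ C₂ : Set X}
    (h₁ : IsClosed C₁) (h₂ : IsClosed C₂) (hcover : C₁ ∪ C₂ = Set.univ) [T2Space C₁]
    [T2Space C₂] : T2Space X := by
  have key : ∀ (C : Set X), IsClosed C → T2Space C → ∀ x y : X, x ≠ y →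
      ∃ E G : Set X, IsClosed E ∧ IsClosed G ∧ x ∉ E ∧ y ∉ G ∧ C ⊆ E ∪ G := by
    intro C hC hT2 x y hxy
    by_cases hx : x ∈ C
    · by_cases hy : y ∈ C
      · obtain ⟨u, v, hu, hv, hxu, hyv, huv⟩ :=
          t2_separation (show (⟨x, hx⟩ : C) ≠ ⟨y, hy⟩ from fun h => hxy (congrArg Subtype.val h))
        refine ⟨Subtype.val '' uᶜ, Subtype.val '' vᶜ,
          hC.isClosedEmbedding_subtypeVal.isClosedMap _ hu.isClosed_compl,
          hC.isClosedEmbedding_subtypeVal.isClosedMap _ hv.isClosed_compl, ?_, ?_, ?_⟩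
        · rintro ⟨a, ha, rfl⟩
          exact ha hxu
        · rintro ⟨a, ha, rfl⟩
          exact ha hyv
        · intro a ha
          rw [← Set.image_union, ← Set.compl_inter, huv.inter_eq, Set.compl_empty]
          exact ⟨⟨a, ha⟩, trivial, rfl⟩
      · exact ⟨∅, C, isClosed_empty, hC, by simp, hy, by simp⟩
    · exact ⟨C, ∅, hC, isClosed_empty, hx, by simp, by simp⟩
  refine ⟨fun x y hxy => ?_⟩
  obtain ⟨E₁, G₁, hE₁, hG₁, hx₁, hy₁, hc₁⟩ := key C₁ h₁ inferInstance x y hxy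
  obtain ⟨E₂, G₂, hE₂, hG₂, hx₂, hy₂, hc₂⟩ := key C₂ h₂ inferInstance x y hxy
  refine ⟨(E₁ ∪ E₂)ᶜ, (G₁ ∪ G₂)ᶜ, (hE₁.union hE₂).isOpen_compl, (hG₁.union hG₂).isOpen_compl,
    by simp [hx₁, hx₂], by simp [hy₁, hy₂], ?_⟩
  rw [Set.disjoint_compl_left_iff_subset]
  intro a ha
  have : a ∈ C₁ ∪ C₂ := hcover ▸ Set.mem_univ a
  rcases this with h | h
  · rcases hc₁ h with h | h
    · exact Or.inl h
    · exact absurd (Or.inl h) ha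
  · rcases hc₂ h with h | h
    · exact Or.inr h
    · exact absurd (Or.inr h) ha

namespace ConnectedSumData

variable {n : ℕ} {N M₁ M₂ : Type} [TopologicalSpace N] [TopologicalSpace M₁]
  [TopologicalSpace M₂]

/-- Exchanging the two summands of a connected sum. -/
def symm (D : ConnectedSumData n N M₁ M₂) : ConnectedSumData n N M₂ M₁ where
  φ₁ := D.φ₂
  φ₂ := D.φ₁
  emb₁ := D.emb₂
  emb₂ := D.emb₁
  C₁ := D.C₂
  C₂ := D.C₁
  closed₁ := D.closed₂
  closed₂ := D.closed₁
  cover := by rw [Set.union_comm, D.cover]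
  h₁ := D.h₂
  h₂ := D.h₁
  inter₁ := D.inter₂
  inter₂ := D.inter₁

theorem mem_or_mem (D : ConnectedSumData n N M₁ M₂) (a : N) : a ∈ D.C₁ ∨ a ∈ D.C₂ :=
  (Set.mem_union _ _ _).1 (D.cover ▸ Set.mem_univ a)

theorem t2Space (D : ConnectedSumData n N M₁ M₂) [T2Space M₁] [T2Space M₂] : T2Space N := by
  have := D.h₁.symm.t2Space
  have := D.h₂.symm.t2Space
  exact t2Space_of_closed_union D.closed₁ D.closed₂ D.cover

theorem isCompact_fst (D : ConnectedSumData n N M₁ M₂) [CompactSpace M₁] : IsCompact D.C₁ := by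
  have : CompactSpace ↥((D.φ₁ '' Metric.ball 0 1)ᶜ : Set M₁) := isCompact_iff_compactSpace.1
    (D.emb₁.isOpenMap _ Metric.isOpen_ball).isClosed_compl.isCompact
  exact isCompact_iff_compactSpace.2 D.h₁.symm.compactSpace

theorem compactSpace (D : ConnectedSumData n N M₁ M₂) [CompactSpace M₁] [CompactSpace M₂] :
    CompactSpace N :=
  ⟨D.cover ▸ D.isCompact_fst.union D.symm.isCompact_fst⟩

/-- The first summand with a point of the ball removed maps to the connected sum, inverting the
identification `D.h₁`. -/
theorem exists_map_compl_singleton (D : ConnectedSumData n N M₁ M₂) [T2Space M₁]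
    {z : EuclideanSpace ℝ (Fin n)} (hz : ‖z‖ < 1) :
    ∃ b : C(↥({D.φ₁ z}ᶜ : Set M₁), N), Set.range b = D.C₁ ∧
      ∀ (a : D.C₁) (ha : (D.h₁ a : M₁) ∈ ({D.φ₁ z}ᶜ : Set M₁)), b ⟨D.h₁ a, ha⟩ = a := by
  obtain ⟨r, hr⟩ := exists_retraction_compl_ball D.emb₁ hz
  have hinv : ∀ (a : D.C₁) (ha : (D.h₁ a : M₁) ∈ ({D.φ₁ z}ᶜ : Set M₁)),
      ((D.h₁.symm (r ⟨D.h₁ a, ha⟩) : D.C₁) : N) = a := by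
    intro a ha
    rw [hr _ (D.h₁ a).2 ha]
    simp
  refine ⟨⟨fun m => D.h₁.symm (r m), by fun_prop⟩, ?_, hinv⟩
  refine Set.Subset.antisymm ?_ fun a ha => ?_
  · rintro _ ⟨m, rfl⟩
    exact (D.h₁.symm (r m)).2
  · refine ⟨⟨D.h₁ ⟨a, ha⟩, fun h => (D.h₁ ⟨a, ha⟩).2 ?_⟩, hinv ⟨a, ha⟩ _⟩
    rw [Set.mem_singleton_iff.1 h]
    exact ⟨z, by simpa using hz, rfl⟩

theorem isPathConnected_fst {k l : ℕ}
    (D : ConnectedSumData n N (unitSphere (k + 1) × unitSphere (l + 1)) M₂) :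
    IsPathConnected D.C₁ := by
  obtain ⟨b, hb, -⟩ := D.exists_map_compl_singleton (z := 0) (by simp)
  have := isPathConnected_iff_pathConnectedSpace.1
    (isPathConnected_compl_singleton_prod_unitSphere (D.φ₁ 0))
  exact hb ▸ isPathConnected_range b.continuous

/-- The part of the connected sum that lies off the second piece and is mapped to `V` under the
identification of the first piece. -/
def pull (D : ConnectedSumData n N M₁ M₂) (V : Set M₁) : Set N :=
  D.C₂ᶜ ∩ Subtype.val '' ((fun a => (D.h₁ a : M₁)) ⁻¹' V)

theorem isOpen_pull (D : ConnectedSumData n N M₁ M₂) {V : Set M₁} (hV : IsOpen V) :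
    IsOpen (D.pull V) := by
  have : IsOpen ((fun a => (D.h₁ a : M₁)) ⁻¹' V) := hV.preimage (by fun_prop)
  obtain ⟨O, hO, hOV⟩ := isOpen_induced_iff.1 this
  rw [pull, ← hOV, Subtype.image_preimage_coe, Set.inter_comm D.C₁, Set.inter_comm,
    Set.inter_assoc]
  rw [Set.inter_eq_right.2 (fun a ha => (D.mem_or_mem a).resolve_right ha : D.C₂ᶜ ⊆ D.C₁)]
  exact hO.inter D.closed₂.isOpen_compl

theorem pull_union (D : ConnectedSumData n N M₁ M₂) (V W : Set M₁) :
    D.pull (V ∪ W) = D.pull V ∪ D.pull W := by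
  simp only [pull, Set.preimage_union, Set.image_union, Set.inter_union_distrib_left]

theorem closure_pull_subset (D : ConnectedSumData n N M₁ M₂) (V : Set M₁) :
    closure (D.pull V) ⊆ Subtype.val '' ((fun a => (D.h₁ a : M₁)) ⁻¹' closure V) := by
  refine closure_minimal (fun a ha => Set.image_mono (Set.preimage_mono subset_closure) ha.2) ?_
  exact D.closed₁.isClosedEmbedding_subtypeVal.isClosedMap _
    (isClosed_closure.preimage (by fun_prop))

theorem nullIn_pull (D : ConnectedSumData n N M₁ M₂) [T2Space M₁] [PathConnectedSpace N]
    {z : EuclideanSpace ℝ (Fin n)} (hz : ‖z‖ < 1) {V Y : Set M₁} (hVY : V ⊆ Y)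
    (hY : Y ⊆ {D.φ₁ z}ᶜ) [ContractibleSpace Y] : NullIn (D.pull V) := by
  obtain ⟨b, -, hb⟩ := D.exists_map_compl_singleton hz
  have hmem : ∀ a : D.pull V, ∃ ha : (a : N) ∈ D.C₁, (D.h₁ ⟨a, ha⟩ : M₁) ∈ V := by
    rintro ⟨_, -, a, ha, rfl⟩
    exact ⟨a.2, ha⟩
  let f : C(D.pull V, Y) :=
    ⟨fun a => ⟨D.h₁ ⟨a, (hmem a).1⟩, hVY (hmem a).2⟩, by fun_prop⟩
  apply NullIn.of_nullhomotopic
  convert ((id_nullhomotopic Y).comp_right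
    (b.comp (ContinuousMap.inclusion hY))).comp_left f using 1
  ext a
  exact (hb ⟨a, (hmem a).1⟩ (hY (hVY (hmem a).2))).symm

/-- Off the second piece, the connected sum is covered by two null-homotopic open sets, the second
of which stays away from a given point of the first piece. -/
theorem exists_cover_compl_snd {k l : ℕ} [PathConnectedSpace N]
    (D : ConnectedSumData n N (unitSphere (k + 1) × unitSphere (l + 1)) M₂) {x : N}
    (hx : x ∈ D.C₁) :
    ∃ A B : Set N, IsOpen A ∧ IsOpen B ∧ A ∪ B = D.C₂ᶜ ∧ x ∉ closure B ∧ NullIn A ∧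
      NullIn B := by
  obtain ⟨_, ⟨z, hz, rfl⟩, hne₁, hne₂⟩ :=
    (dense_setOf_fst_ne_and_snd_ne (D.h₁ ⟨x, hx⟩ : unitSphere (k + 1) × unitSphere (l + 1))
      ).inter_open_nonempty _ (D.emb₁.isOpenMap _ (Metric.isOpen_ball (x := 0) (ε := 1)))
      ((Metric.nonempty_ball.2 one_pos).image _)
  obtain ⟨A, B, B', hA, hB, hB', hcover, hdisj, hy, hnull⟩ :=
    exists_cover_compl_singleton hne₁ hne₂
  simp only [Set.mem_insert_iff, Set.mem_singleton_iff, forall_eq_or_imp, forall_eq] at hnull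
  obtain ⟨⟨Y, hY, hAY, _⟩, ⟨Y', hY', hBY', _⟩, ⟨Y'', hY'', hBY'', _⟩⟩ := hnull
  have hz' : ‖z‖ < 1 := by simpa using hz
  have hnA : NullIn (D.pull A) := D.nullIn_pull hz' hAY hY
  have hnB : NullIn (D.pull B) := D.nullIn_pull hz' hBY' hY'
  have hnB' : NullIn (D.pull B') := D.nullIn_pull hz' hBY'' hY''
  refine ⟨D.pull A, D.pull (B ∪ B'), D.isOpen_pull hA, D.isOpen_pull (hB.union hB'), ?_, ?_,
    hnA, ?_⟩
  · rw [← pull_union, hcover]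
    refine Set.inter_eq_left.2 fun a ha => ?_
    have ha₁ := (D.mem_or_mem a).resolve_right ha
    refine ⟨⟨a, ha₁⟩, fun h => (D.h₁ ⟨a, ha₁⟩).2 ?_, rfl⟩
    exact ⟨z, hz, (Set.mem_singleton_iff.1 h).symm⟩
  · intro hcl
    obtain ⟨a, ha, rfl⟩ := D.closure_pull_subset _ hcl
    exact hy ha
  · rw [pull_union]
    refine NullIn.union (D.isOpen_pull hB) (D.isOpen_pull hB') ?_ hnB hnB'
    refine Set.disjoint_left.2 ?_
    rintro _ ⟨-, a, ha, rfl⟩ ⟨-, b, hb, h⟩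
    rw [Subtype.ext h] at hb
    exact Set.disjoint_left.1 hdisj ha hb

/-- The part of the first piece lying in the chart around the ball. -/
def collar (D : ConnectedSumData n N M₁ M₂) : Set N :=
  {a | ∃ ha : a ∈ D.C₁, (D.h₁ ⟨a, ha⟩ : M₁) ∈ Set.range D.φ₁}

/-- The collar deforms radially onto the separating sphere. -/
theorem exists_collar_homotopy (D : ConnectedSumData n N M₁ M₂) :
    ∃ j : C(I × D.collar, N), (∀ a, j (0, a) = a) ∧ (∀ a, j (1, a) ∈ D.C₁ ∩ D.C₂) ∧
      ∀ t (a : D.collar), (a : N) ∈ D.C₂ → j (t, a) = a := by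
  let e := D.emb₁.toOpenPartialHomeomorph D.φ₁
  let w : D.collar → EuclideanSpace ℝ (Fin n) := fun a => e.symm (D.h₁ ⟨a, a.2.1⟩)
  have hφw : ∀ a, D.φ₁ (w a) = D.h₁ ⟨a, a.2.1⟩ := fun a =>
    D.emb₁.toOpenPartialHomeomorph_right_inv D.φ₁ a.2.2
  have hw : Continuous w := by
    have hsymm : ContinuousOn e.symm (Set.range D.φ₁) := by simpa [e] using e.continuousOn_symm
    exact hsymm.comp_continuous (by fun_prop) fun a => a.2.2
  have hnorm : ∀ a, 1 ≤ ‖w a‖ := by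
    intro a
    by_contra! h
    exact (D.h₁ ⟨a, a.2.1⟩).2 ⟨w a, by simpa using h, hφw a⟩
  let L : I × D.collar → EuclideanSpace ℝ (Fin n) := fun p =>
    ((1 - (p.1 : ℝ)) + p.1 / ‖w p.2‖) • w p.2
  have hL : Continuous L := by
    have hdiv : Continuous fun p : I × D.collar => (p.1 : ℝ) / ‖w p.2‖ :=
      Continuous.div (by fun_prop) (by fun_prop) fun p => (one_pos.trans_le (hnorm p.2)).ne'
    fun_prop
  have hLnorm : ∀ p, ‖L p‖ = (1 - (p.1 : ℝ)) * ‖w p.2‖ + p.1 := by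
    intro p
    have h1 := hnorm p.2
    have h2 := p.1.2.1
    have h3 := p.1.2.2
    have h4 : 0 ≤ (1 - (p.1 : ℝ)) + p.1 / ‖w p.2‖ :=
      add_nonneg (by linarith) (div_nonneg h2 (by linarith))
    rw [norm_smul, Real.norm_of_nonneg h4]
    field_simp
  have hLmem : ∀ p, D.φ₁ (L p) ∈ (D.φ₁ '' Metric.ball 0 1)ᶜ := by
    rintro p ⟨v, hv, hvL⟩
    rw [D.emb₁.injective hvL, mem_ball_zero_iff, hLnorm] at hv
    nlinarith [hnorm p.2, p.1.2.1, p.1.2.2]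
  have hcont : Continuous D.φ₁ := D.emb₁.continuous
  have hfix : ∀ p, L p = w p.2 → ((D.h₁.symm ⟨D.φ₁ (L p), hLmem p⟩ : D.C₁) : N) = p.2 := by
    intro p hp
    have : D.h₁.symm ⟨D.φ₁ (L p), hLmem p⟩ = ⟨p.2, p.2.2.1⟩ := by
      rw [Homeomorph.symm_apply_eq]
      exact Subtype.ext ((congrArg D.φ₁ hp).trans (hφw p.2))
    rw [this]
  refine ⟨⟨fun p => D.h₁.symm ⟨D.φ₁ (L p), hLmem p⟩, by fun_prop⟩, fun a => ?_,
    fun a => ⟨Subtype.coe_prop _, ?_⟩, fun t a ha => ?_⟩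
  · exact hfix (0, a) (by simp [L])
  · refine (D.inter₁ _).2 ⟨L (1, a), ?_, by simp⟩
    simp [hLnorm]
  · refine hfix (t, a) ?_
    obtain ⟨v, hv, hva⟩ := (D.inter₁ ⟨a, a.2.1⟩).1 ha
    have : w a = v := D.emb₁.injective ((hφw a).trans hva.symm)
    simp [L, this, mem_sphere_zero_iff_norm.1 hv]

/-- The separating sphere of a connected sum has an open neighbourhood that deforms onto it. -/
theorem exists_neck (D : ConnectedSumData n N M₁ M₂) [T2Space N] :
    ∃ (O : Set N) (θ : C(O, Metric.sphere (0 : EuclideanSpace ℝ (Fin n)) 1))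
      (e : C(Metric.sphere (0 : EuclideanSpace ℝ (Fin n)) 1, N)), IsOpen O ∧
      Function.Injective e ∧ Set.range e = D.C₁ ∩ D.C₂ ∧
      (∀ a ∈ D.C₁ ∩ D.C₂, ∃ ha : a ∈ O, e (θ ⟨a, ha⟩) = a) ∧
      ContinuousMap.Homotopic (⟨Subtype.val, continuous_subtype_val⟩ : C(O, N)) (e.comp θ) := by
  classical
  obtain ⟨j₁, hj₁0, hj₁1, hj₁⟩ := D.exists_collar_homotopy
  obtain ⟨j₂, hj₂0, hj₂1, hj₂⟩ := D.symm.exists_collar_homotopy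
  let O : Set N := {a | (a ∈ D.C₁ → a ∈ D.collar) ∧ (a ∈ D.C₂ → a ∈ D.symm.collar)}
  have hopen : ∀ {M₁ M₂ : Type} [TopologicalSpace M₁] [TopologicalSpace M₂]
      (D : ConnectedSumData n N M₁ M₂), IsOpen {a | a ∈ D.C₁ → a ∈ D.collar} := by
    intro M₁ M₂ _ _ D
    have hc : IsClosed (Subtype.val '' ((fun a => (D.h₁ a : M₁)) ⁻¹' (Set.range D.φ₁)ᶜ)) :=
      D.closed₁.isClosedEmbedding_subtypeVal.isClosedMap _
        (D.emb₁.isOpen_range.isClosed_compl.preimage (by fun_prop))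
    convert hc.isOpen_compl using 1
    ext a
    constructor
    · rintro h ⟨a, ha, rfl⟩
      exact ha (h a.2).2
    · intro h ha
      refine ⟨ha, ?_⟩
      by_contra h'
      exact h ⟨⟨a, ha⟩, h', rfl⟩
  have hO : IsOpen O := (hopen D).inter (hopen D.symm)
  have hsphere : ∀ a ∈ D.C₁ ∩ D.C₂, a ∈ O := by
    rintro a ⟨ha₁, ha₂⟩
    refine ⟨fun _ => ⟨ha₁, ?_⟩, fun _ => ⟨ha₂, ?_⟩⟩
    · obtain ⟨v, -, hv⟩ := (D.inter₁ ⟨a, ha₁⟩).1 ha₂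
      exact ⟨v, hv⟩
    · obtain ⟨v, -, hv⟩ := (D.inter₂ ⟨a, ha₂⟩).1 ha₁
      exact ⟨v, hv⟩
  have hO₂ : ∀ a : O, (a : N) ∉ D.C₁ → (a : N) ∈ D.symm.collar := fun a ha =>
    a.2.2 ((D.mem_or_mem a).resolve_left ha)
  let K : I × O → N := fun p =>
    if h : (p.2 : N) ∈ D.C₁ then j₁ (p.1, ⟨p.2, p.2.2.1 h⟩) else j₂ (p.1, ⟨p.2, hO₂ p.2 h⟩)
  have hK₁ : ∀ p : I × O, ∀ h : (p.2 : N) ∈ D.C₁, K p = j₁ (p.1, ⟨p.2, p.2.2.1 h⟩) :=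
    fun p h => dif_pos h
  have hK₂ : ∀ p : I × O, ∀ h : (p.2 : N) ∈ D.C₂, K p = j₂ (p.1, ⟨p.2, p.2.2.2 h⟩) := by
    intro p h
    by_cases h₁ : (p.2 : N) ∈ D.C₁
    · rw [hK₁ p h₁, hj₁ _ _ h]
      exact (hj₂ p.1 ⟨p.2, p.2.2.2 h⟩ h₁).symm
    · exact dif_neg h₁
  have hK : Continuous K := by
    have huniv : {p : I × O | (p.2 : N) ∈ D.C₁} ∪ {p : I × O | (p.2 : N) ∈ D.C₂} = Set.univ :=
      Set.eq_univ_of_forall fun p => D.mem_or_mem p.2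
    rw [← continuousOn_univ, ← huniv]
    refine ContinuousOn.union_of_isClosed ?_ ?_ (D.closed₁.preimage (by fun_prop))
      (D.closed₂.preimage (by fun_prop))
    · rw [continuousOn_iff_continuous_domRestrict]
      have : Continuous fun p : {p : I × O | (p.2 : N) ∈ D.C₁} =>
        j₁ (p.1.1, ⟨p.1.2, p.1.2.2.1 p.2⟩) := by fun_prop
      exact this.congr fun p => (hK₁ p.1 p.2).symm
    · rw [continuousOn_iff_continuous_domRestrict]
      have : Continuous fun p : {p : I × O | (p.2 : N) ∈ D.C₂} =>
        j₂ (p.1.1, ⟨p.1.2, p.1.2.2.2 p.2⟩) := by fun_prop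
      exact this.congr fun p => (hK₂ p.1 p.2).symm
  have hK0 : ∀ a, K (0, a) = a := by
    intro a
    rcases D.mem_or_mem a with h | h
    · rw [hK₁ _ h, hj₁0]
    · rw [hK₂ _ h, hj₂0]
  have hK1 : ∀ a, K (1, a) ∈ D.C₁ ∩ D.C₂ := by
    intro a
    rcases D.mem_or_mem a with h | h
    · rw [hK₁ _ h]
      exact hj₁1 _
    · rw [hK₂ _ h]
      exact (hj₂1 _).symm
  have hmem : ∀ q : Metric.sphere (0 : EuclideanSpace ℝ (Fin n)) 1,
      D.φ₁ q ∈ (D.φ₁ '' Metric.ball 0 1)ᶜ := by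
    rintro q ⟨v, hv, hvq⟩
    rw [D.emb₁.injective hvq, Metric.mem_ball, Metric.mem_sphere.1 q.2] at hv
    exact lt_irrefl _ hv
  have hcont : Continuous D.φ₁ := D.emb₁.continuous
  let e : C(Metric.sphere (0 : EuclideanSpace ℝ (Fin n)) 1, N) :=
    ⟨fun q => D.h₁.symm ⟨D.φ₁ q, hmem q⟩, by fun_prop⟩
  have hinj : Function.Injective e := by
    intro q q' h
    have := congrArg Subtype.val (D.h₁.symm.injective (Subtype.ext h))
    exact Subtype.ext (D.emb₁.injective this)
  have hrange : Set.range e = D.C₁ ∩ D.C₂ := by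
    refine Set.Subset.antisymm ?_ ?_
    · rintro _ ⟨q, rfl⟩
      refine ⟨Subtype.coe_prop _, (D.inter₁ _).2 ⟨q, q.2, by simp⟩⟩
    · rintro a ⟨ha₁, ha₂⟩
      obtain ⟨v, hv, hva⟩ := (D.inter₁ ⟨a, ha₁⟩).1 ha₂
      refine ⟨⟨v, hv⟩, ?_⟩
      have : D.h₁.symm ⟨D.φ₁ v, hmem ⟨v, hv⟩⟩ = ⟨a, ha₁⟩ := by
        rw [Homeomorph.symm_apply_eq]
        exact Subtype.ext hva
      exact congrArg Subtype.val this
  have hemb := (e.continuous.isClosedEmbedding hinj).isEmbedding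
  let θ : C(O, Metric.sphere (0 : EuclideanSpace ℝ (Fin n)) 1) :=
    ⟨fun a => hemb.toHomeomorph.symm ⟨K (1, a), hrange ▸ hK1 a⟩, by fun_prop⟩
  have hθ : ∀ a, e (θ a) = K (1, a) := fun a =>
    congrArg Subtype.val (hemb.toHomeomorph.apply_symm_apply ⟨K (1, a), hrange ▸ hK1 a⟩)
  refine ⟨O, θ, e, hO, hinj, hrange, fun a ha => ⟨hsphere a ha, ?_⟩, ⟨⟨⟨K, hK⟩, hK0, ?_⟩⟩⟩
  · rw [hθ, hK₁ _ ha.1, hj₁ _ _ ha.2]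
  · exact fun a => (hθ a).symm

end ConnectedSumData

/-- A connected sum of two products of spheres of positive dimensions is covered by three
null-homotopic open sets. -/
theorem exists_nullIn_cover_connectedSum {n k l k' l' : ℕ} {N : Type} [TopologicalSpace N]
    [PathConnectedSpace N] [T2Space N]
    (D : ConnectedSumData (n + 1) N (unitSphere (k + 1) × unitSphere (l + 1))
      (unitSphere (k' + 1) × unitSphere (l' + 1))) :
    ∃ U : Fin 3 → Set N, (∀ i, IsOpen (U i)) ∧ ⋃ i, U i = Set.univ ∧ ∀ i, NullIn (U i) := by
  obtain ⟨O, θ, e, hO, hinj, hrange, hθ, hhom⟩ := D.exists_neck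
  obtain ⟨q⟩ : Nonempty (unitSphere n) := (NormedSpace.sphere_nonempty.2 zero_le_one).to_subtype
  have hq : e q ∈ D.C₁ ∩ D.C₂ := hrange ▸ Set.mem_range_self q
  obtain ⟨A₁, B₁, hA₁, hB₁, hc₁, hx₁, hnA₁, hnB₁⟩ := D.exists_cover_compl_snd hq.1
  obtain ⟨A₂, B₂, hA₂, hB₂, hc₂, hx₂, hnA₂, hnB₂⟩ := D.symm.exists_cover_compl_snd hq.2
  let P : unitSphere n → Set N := fun v => Subtype.val '' (θ ⁻¹' {v}ᶜ)
  have hP : ∀ v, IsOpen (P v) := fun v =>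
    hO.isOpenMap_subtype_val _ (isOpen_compl_singleton.preimage θ.continuous)
  have hnP : ∀ v, NullIn (P v) := by
    intro v
    have hv : ∀ a : P v, ∃ ha : (a : N) ∈ O, θ ⟨a, ha⟩ ∈ ({v}ᶜ : Set (unitSphere n)) := by
      rintro ⟨_, a, ha, rfl⟩
      exact ⟨a.2, ha⟩
    have := contractibleSpace_compl_singleton_unitSphere n v
    let f : C(P v, O) := ⟨fun a => ⟨a, (hv a).1⟩, by fun_prop⟩
    let g : C(P v, ↥({v}ᶜ : Set (unitSphere n))) := ⟨fun a => ⟨θ (f a), (hv a).2⟩, by fun_prop⟩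
    have hnull := ((id_nullhomotopic ↥({v}ᶜ : Set (unitSphere n))).comp_right
      (e.comp ⟨Subtype.val, continuous_subtype_val⟩)).comp_left g
    obtain ⟨c, hc⟩ := hnull
    exact NullIn.of_nullhomotopic ⟨c, (hhom.comp (.refl f)).trans hc⟩
  have hsub₁ : A₁ ⊆ D.C₂ᶜ ∧ B₁ ⊆ D.C₂ᶜ := Set.union_subset_iff.1 hc₁.subset
  have hsub₂ : A₂ ⊆ D.C₁ᶜ ∧ B₂ ⊆ D.C₁ᶜ := Set.union_subset_iff.1 hc₂.subset
  have hdisj : Disjoint D.C₂ᶜ D.C₁ᶜ :=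
    Set.disjoint_left.2 fun a ha ha' => (D.mem_or_mem a).elim ha' ha
  let T : Set N := P (-q) ∩ (closure B₁ ∪ closure B₂)ᶜ
  have hT : IsOpen T := (hP _).inter (isClosed_closure.union isClosed_closure).isOpen_compl
  have hqT : e q ∈ T := by
    obtain ⟨ha, hea⟩ := hθ _ hq
    refine ⟨⟨⟨e q, ha⟩, ?_, rfl⟩, fun h => h.elim hx₁ hx₂⟩
    rw [Set.mem_preimage, hinj hea]
    exact ne_neg_of_mem_unit_sphere ℝ q
  have hBT : Disjoint (B₁ ∪ B₂) T := Set.disjoint_left.2 fun a ha haT =>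
    haT.2 (ha.imp (fun h => subset_closure h) fun h => subset_closure h)
  refine ⟨![A₁ ∪ A₂, B₁ ∪ B₂ ∪ T, P q], ?_, ?_, ?_⟩
  · simp only [Fin.forall_fin_succ, Fin.isValue]
    exact ⟨hA₁.union hA₂, (hB₁.union hB₂).union hT, hP q, fun i => i.elim0⟩
  · refine Set.eq_univ_of_forall fun a => Set.mem_iUnion.2 ?_
    by_cases ha₂ : a ∈ D.C₂
    · by_cases ha₁ : a ∈ D.C₁
      · obtain ⟨ha, hea⟩ := hθ a ⟨ha₁, ha₂⟩
        by_cases haq : θ ⟨a, ha⟩ = q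
        · refine ⟨1, Or.inr ?_⟩
          rwa [← hea, haq]
        · exact ⟨2, ⟨a, ha⟩, haq, rfl⟩
      · rcases hc₂.superset ha₁ with h | h
        · exact ⟨0, Or.inr h⟩
        · exact ⟨1, Or.inl (Or.inr h)⟩
    · rcases hc₁.superset ha₂ with h | h
      · exact ⟨0, Or.inl h⟩
      · exact ⟨1, Or.inl (Or.inl h)⟩
  · simp only [Fin.forall_fin_succ, Fin.isValue]
    refine ⟨NullIn.union hA₁ hA₂ (hdisj.mono hsub₁.1 hsub₂.1) hnA₁ hnA₂, ?_, hnP q, fun i => i.elim0⟩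
    exact NullIn.union (hB₁.union hB₂) hT hBT
      (NullIn.union hB₁ hB₂ (hdisj.mono hsub₁.2 hsub₂.2) hnB₁ hnB₂)
      ((hnP (-q)).mono Set.inter_subset_left)

/-- **Example.**  `TC((S² × S¹) # (S² × S¹)) ≤ 5`. -/
theorem tc_connectedSum_s2_times_s1_le
    (N : Type) [TopologicalSpace N]
    (hN : IsConnectedSum 3 N (unitSphere 2 × unitSphere 1)
      (unitSphere 2 × unitSphere 1)) :
    topologicalComplexity N ≤ 5 := by
  obtain ⟨D⟩ := hN
  have := D.t2Space
  have := D.compactSpace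
  have hne : (D.C₁ ∩ D.C₂).Nonempty := by
    obtain ⟨O, θ, e, -, -, hrange, -⟩ := D.exists_neck
    obtain ⟨q⟩ : Nonempty (unitSphere 2) := (NormedSpace.sphere_nonempty.2 zero_le_one).to_subtype
    exact ⟨e q, hrange ▸ Set.mem_range_self q⟩
  have : PathConnectedSpace N := pathConnectedSpace_iff_univ.2
    (D.cover ▸ D.isPathConnected_fst.union D.symm.isPathConnected_fst hne)
  obtain ⟨U, hopen, hcover, hnull⟩ := exists_nullIn_cover_connectedSum D
  exact sInf_le ⟨5, rfl, TCCoverable.of_nullIn U hopen hcover hnull⟩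

end
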